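/- arXiv:2003.10204 — 2 statements merged into one kernel-verified Lean document; each statement's English description precedes it below -/
import Mathlib

section
/- Let n ≥ 1 be a natural number and let λ₁, …, λₙ be positive real numbers with product p = λ₁⋯λₙ. Then |p^{1/4} − p^{-1/4}| ≤ max_{1 ≤ i ≤ n} |λᵢ^{n/4} − λᵢ^{-n/4}|. -/
theorem Real.abs_rpow_sub_rpow_neg {x : ℝ} (hx : 0 < x) (a : ℝ) :
    |x ^ a - x ^ (-a)| = 2 * Real.sinh |a * Real.log x| := by
  rw [← Real.abs_sinh, Real.sinh_eq, abs_div, abs_two, mul_div_cancel₀ _ two_ne_zero,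
    Real.rpow_def_of_pos hx, Real.rpow_def_of_pos hx, mul_comm (Real.log x) a,
    mul_comm (Real.log x) (-a), neg_mul]

theorem Finset.exists_abs_sum_le_card_mul_abs {ι : Type*} {s : Finset ι} (hs : s.Nonempty)
    (f : ι → ℝ) : ∃ i ∈ s, |∑ j ∈ s, f j| ≤ s.card * |f i| := by
  refine Finset.exists_le_of_sum_le hs ?_
  rw [Finset.sum_const, nsmul_eq_mul, ← Finset.mul_sum]
  gcongr
  exact Finset.abs_sum_le_sum_abs f s

/-- For positive reals `λ₁, …, λₙ` (`n ≥ 1`) with product `p`, one has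
`|p^(1/4) − p^(-1/4)| ≤ max_i |λᵢ^(n/4) − λᵢ^(-n/4)|`. -/
theorem stmt2 (n : ℕ) (hn : 1 ≤ n) (lam : Fin n → ℝ) (hlam : ∀ i, 0 < lam i) :
    |(∏ i, lam i) ^ ((1 : ℝ)/4) - (∏ i, lam i) ^ (-(1 : ℝ)/4)| ≤
      Finset.univ.sup' (Finset.univ_nonempty_iff.mpr ⟨⟨0, hn⟩⟩)
        (fun i => |lam i ^ ((n : ℝ)/4) - lam i ^ (-(n : ℝ)/4)|) := by
  have hne : (Finset.univ : Finset (Fin n)).Nonempty := Finset.univ_nonempty_iff.mpr ⟨⟨0, hn⟩⟩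
  obtain ⟨i, hi, hle⟩ := Finset.exists_abs_sum_le_card_mul_abs hne (fun j => Real.log (lam j))
  rw [Finset.card_univ, Fintype.card_fin] at hle
  refine le_trans ?_ (Finset.le_sup' _ hi)
  rw [neg_div, neg_div, Real.abs_rpow_sub_rpow_neg (Finset.prod_pos fun j _ => hlam j),
    Real.abs_rpow_sub_rpow_neg (hlam i), Real.log_prod fun j _ => (hlam j).ne']
  refine mul_le_mul_of_nonneg_left (Real.sinh_le_sinh.mpr ?_) zero_le_two
  rw [abs_mul, abs_mul, abs_of_nonneg (by positivity : (0 : ℝ) ≤ 1 / 4),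
    abs_of_nonneg (by positivity : (0 : ℝ) ≤ n / 4)]
  linarith
end

section
/- Let V be a finite-dimensional real vector space, g an inner product on V, P : V → V a positive-definite g-self-adjoint linear map, A := P∘P, and h the inner product h(x, y) := g(A x, y). Let T : V → End(V) be a linear map and define S : V → End(V) by S(v) := −P⁻¹ ∘ T(v) ∘ P. Then sup_{h(v,v) ≤ 1} ‖S(v)‖_h ≤ ‖A⁻¹‖_g^{3/2} · ‖A‖_g · sup_{g(v,v) ≤ 1} ‖T(v)‖_g, where ‖·‖_g and ‖·‖_h denote the operator norms of endomorphisms of V with respect to g and h respectively. -/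
/-- The operator norm of an endomorphism `B` of `V` with respect to the inner product given
by a bilinear form `gb` on `V`: `sup_{gb(v,v) ≤ 1} √(gb (B v) (B v))`. -/
noncomputable def opNormWrt {V : Type*} [AddCommGroup V] [Module ℝ V]
    (gb : V →ₗ[ℝ] V →ₗ[ℝ] ℝ) (B : V →ₗ[ℝ] V) : ℝ :=
  ⨆ v : {v : V // gb v v ≤ 1}, Real.sqrt (gb (B ↑v) (B ↑v))

open scoped InnerProductSpace

theorem ContinuousLinearMap.iSup_inner_self_le_one_eq_norm {E F : Type*}
    [NormedAddCommGroup E] [InnerProductSpace ℝ E] [NormedAddCommGroup F] [NormedSpace ℝ F]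
    (f : E →L[ℝ] F) : ⨆ v : {v : E // ⟪v, v⟫_ℝ ≤ 1}, ‖f v‖ = ‖f‖ := by
  have hball : {v : E | ⟪v, v⟫_ℝ ≤ 1} = Metric.closedBall 0 1 := by
    ext v
    simp
  rw [← f.sSup_unitClosedBall_eq_norm, ← hball, sSup_image']
  rfl

theorem opNormWrt_innerₗ {E : Type*} [NormedAddCommGroup E] [InnerProductSpace ℝ E]
    (B : E →L[ℝ] E) : opNormWrt (innerₗ E) B = ‖B‖ := by
  simp only [opNormWrt, innerₗ_apply_apply, ContinuousLinearMap.coe_coe,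
    real_inner_self_eq_norm_mul_norm, Real.sqrt_mul_self (norm_nonneg _)]
  simpa only [real_inner_self_eq_norm_mul_norm] using B.iSup_inner_self_le_one_eq_norm

theorem LinearMap.IsSymmetric.norm_sq_le_norm_comp_self {E : Type*} [NormedAddCommGroup E]
    [InnerProductSpace ℝ E] {Q : E →L[ℝ] E} (hQ : (Q : E →ₗ[ℝ] E).IsSymmetric) :
    ‖Q‖ ^ 2 ≤ ‖Q ∘L Q‖ := by
  refine (Real.le_sqrt (norm_nonneg _) (norm_nonneg _)).1 ?_
  refine Q.opNorm_le_bound (Real.sqrt_nonneg _) fun x => ?_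
  refine abs_le_of_sq_le_sq' ?_ (by positivity) |>.2
  rw [mul_pow, Real.sq_sqrt (norm_nonneg _), ← real_inner_self_eq_norm_sq]
  calc ⟪Q x, Q x⟫_ℝ = ⟪x, (Q ∘L Q) x⟫_ℝ := hQ x (Q x)
    _ ≤ ‖x‖ * ‖(Q ∘L Q) x‖ := real_inner_le_norm _ _
    _ ≤ ‖x‖ * (‖Q ∘L Q‖ * ‖x‖) := by gcongr; exact (Q ∘L Q).le_opNorm x
    _ = ‖Q ∘L Q‖ * ‖x‖ ^ 2 := by ring

theorem norm_le_rpow_norm_comp_self_mul {E : Type*} [NormedAddCommGroup E]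
    [InnerProductSpace ℝ E] {P Q : E →L[ℝ] E} (hQ : (Q : E →ₗ[ℝ] E).IsSymmetric)
    (hQP : Q ∘L P = .id ℝ E) :
    ‖Q‖ ≤ ‖Q ∘L Q‖ ^ ((3 : ℝ) / 2) * ‖P ∘L P‖ := by
  rcases subsingleton_or_nontrivial E with _ | _
  · rw [Subsingleton.elim Q 0, norm_zero]
    positivity
  have hone : 1 ≤ ‖Q ∘L Q‖ * ‖P ∘L P‖ := by
    have hid : (Q ∘L Q) ∘L (P ∘L P) = .id ℝ E := by
      rw [ContinuousLinearMap.comp_assoc, ← ContinuousLinearMap.comp_assoc Q P P, hQP,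
        ContinuousLinearMap.id_comp, hQP]
    simpa [hid] using (Q ∘L Q).opNorm_comp_le (P ∘L P)
  have hpow : ‖Q ∘L Q‖ ^ ((3 : ℝ) / 2) = √‖Q ∘L Q‖ * ‖Q ∘L Q‖ := by
    rw [Real.sqrt_eq_rpow, ← Real.rpow_add_one' (norm_nonneg _) (by norm_num)]
    norm_num
  rw [hpow, mul_assoc]
  exact (Real.le_sqrt_of_sq_le hQ.norm_sq_le_norm_comp_self).trans
    (le_mul_of_one_le_right (Real.sqrt_nonneg _) hone)

theorem iSup_opNormWrt_skew_le {E : Type*} [NormedAddCommGroup E] [InnerProductSpace ℝ E]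
    {P Q : E →L[ℝ] E} (hP : (P : E →ₗ[ℝ] E).IsSymmetric) (hQP : Q ∘L P = .id ℝ E)
    (hPQ : P ∘L Q = .id ℝ E) {h : E →ₗ[ℝ] E →ₗ[ℝ] ℝ}
    (hdef : ∀ x y, h x y = ⟪P (P x), y⟫_ℝ) (T : E →L[ℝ] E →L[ℝ] E) :
    (⨆ v : {v : E // h v v ≤ 1}, opNormWrt h (-((Q : E →ₗ[ℝ] E) ∘ₗ (T v : E →ₗ[ℝ] E) ∘ₗ P))) ≤
      ‖Q ∘L Q‖ ^ ((3 : ℝ) / 2) * ‖P ∘L P‖ * ‖T‖ := by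
  have hQP' (x : E) : Q (P x) = x := DFunLike.congr_fun hQP x
  have hPQ' (x : E) : P (Q x) = x := DFunLike.congr_fun hPQ x
  have hQ : (Q : E →ₗ[ℝ] E).IsSymmetric := fun x y => by
    simpa [hPQ'] using (hP (Q x) (Q y)).symm
  have hnorm (x : E) : h x x = ‖P x‖ ^ 2 := by
    rw [hdef, ← real_inner_self_eq_norm_sq]
    exact hP (P x) x
  have hle (x : E) (hx : h x x ≤ 1) : ‖P x‖ ≤ 1 := by
    rwa [hnorm, sq_le_one_iff₀ (norm_nonneg _)] at hx
  have : Nonempty {v : E // h v v ≤ 1} := ⟨⟨0, by simp⟩⟩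
  refine ciSup_le fun v => ciSup_le fun x => ?_
  calc √(h _ _) = ‖T v (P x)‖ := by simp [hnorm, hPQ', Real.sqrt_sq]
    _ ≤ ‖T v‖ := (T v).unit_le_opNorm _ (hle x x.2)
    _ = ‖T (Q (P v))‖ := by rw [hQP']
    _ ≤ ‖T‖ * ‖Q (P v)‖ := T.le_opNorm _
    _ ≤ ‖T‖ * ‖Q‖ := by gcongr; exact Q.unit_le_opNorm _ (hle v v.2)
    _ ≤ ‖T‖ * (‖Q ∘L Q‖ ^ ((3 : ℝ) / 2) * ‖P ∘L P‖) := by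
      gcongr
      exact norm_le_rpow_norm_comp_self_mul hQ hQP
    _ = _ := mul_comm _ _

theorem iSup_opNormWrt_skew_le_innerₗ {E : Type*} [NormedAddCommGroup E]
    [InnerProductSpace ℝ E] [FiniteDimensional ℝ E] {P Q : E →ₗ[ℝ] E} (hP : P.IsSymmetric)
    (hQP : Q ∘ₗ P = LinearMap.id) (hPQ : P ∘ₗ Q = LinearMap.id) {h : E →ₗ[ℝ] E →ₗ[ℝ] ℝ}
    (hdef : ∀ x y, h x y = ⟪P (P x), y⟫_ℝ) (T : E →ₗ[ℝ] E →ₗ[ℝ] E) :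
    (⨆ v : {v : E // h v v ≤ 1}, opNormWrt h (-(Q ∘ₗ T v ∘ₗ P))) ≤
      opNormWrt (innerₗ E) (Q ∘ₗ Q) ^ ((3 : ℝ) / 2) * opNormWrt (innerₗ E) (P ∘ₗ P) *
        ⨆ v : {v : E // innerₗ E v v ≤ 1}, opNormWrt (innerₗ E) (T v) := by
  let toCLM := LinearMap.toContinuousLinearMap (𝕜 := ℝ) (E := E) (F' := E)
  let T' : E →L[ℝ] E →L[ℝ] E := LinearMap.toContinuousLinearMap (toCLM.toLinearMap ∘ₗ T)
  have hT : (⨆ v : {v : E // innerₗ E v v ≤ 1}, opNormWrt (innerₗ E) (T v)) = ‖T'‖ := by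
    rw [← T'.iSup_inner_self_le_one_eq_norm]
    exact iSup_congr fun v => opNormWrt_innerₗ (T' v)
  have hQQ : opNormWrt (innerₗ E) (Q ∘ₗ Q) = ‖toCLM Q ∘L toCLM Q‖ :=
    opNormWrt_innerₗ (toCLM Q ∘L toCLM Q)
  have hPP : opNormWrt (innerₗ E) (P ∘ₗ P) = ‖toCLM P ∘L toCLM P‖ :=
    opNormWrt_innerₗ (toCLM P ∘L toCLM P)
  rw [hT, hQQ, hPP]
  exact iSup_opNormWrt_skew_le (P := toCLM P) (Q := toCLM Q) hP
    (ContinuousLinearMap.coe_injective hQP) (ContinuousLinearMap.coe_injective hPQ) hdef T'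

/-- Let `V` be a finite-dimensional real vector space, `g` an inner product,
`P` positive-definite `g`-self-adjoint, `A := P ∘ P`, and `h (x, y) := g (A x) y`. For a
linear map `T : V → End(V)`, setting `S v := −P⁻¹ ∘ T v ∘ P`, one has
`sup_{h(v,v) ≤ 1} ‖S v‖_h ≤ ‖A⁻¹‖_g^(3/2) · ‖A‖_g · sup_{g(v,v) ≤ 1} ‖T v‖_g`. -/
theorem stmt14 {V : Type*} [AddCommGroup V] [Module ℝ V] [FiniteDimensional ℝ V]
    (g : V →ₗ[ℝ] V →ₗ[ℝ] ℝ)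
    (hgsymm : ∀ x y : V, g x y = g y x)
    (hgpos : ∀ x : V, x ≠ 0 → 0 < g x x)
    (P : V →ₗ[ℝ] V)
    (hPsa : ∀ x y : V, g (P x) y = g x (P y))
    (hPpos : ∀ x : V, x ≠ 0 → 0 < g (P x) x)
    (Q : V →ₗ[ℝ] V)
    (hQP : Q ∘ₗ P = LinearMap.id)
    (hPQ : P ∘ₗ Q = LinearMap.id)
    (h : V →ₗ[ℝ] V →ₗ[ℝ] ℝ)
    (hdef : ∀ x y : V, h x y = g ((P ∘ₗ P) x) y)
    (T : V →ₗ[ℝ] (V →ₗ[ℝ] V)) :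
    (⨆ v : {v : V // h v v ≤ 1}, opNormWrt h (-(Q ∘ₗ T ↑v ∘ₗ P))) ≤
      (opNormWrt g (Q ∘ₗ Q)) ^ ((3 : ℝ)/2) * opNormWrt g (P ∘ₗ P) *
        ⨆ v : {v : V // g v v ≤ 1}, opNormWrt g (T ↑v) := by
  let core : InnerProductSpace.Core ℝ V :=
    { inner := fun x y => g x y
      conj_inner_symm := fun x y => hgsymm y x
      re_inner_nonneg := fun x => by
        rcases eq_or_ne x 0 with rfl | hx
        · simp
        · exact (hgpos x hx).le
      add_left := fun x y z => by simp
      smul_left := fun x y r => by simp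
      definite := fun x hx => by
        by_contra hne
        exact (hgpos x hne).ne' hx }
  let _ : NormedAddCommGroup V := core.toNormedAddCommGroup
  let _ : InnerProductSpace ℝ V := InnerProductSpace.ofCore core.toCore
  exact iSup_opNormWrt_skew_le_innerₗ hPsa hQP hPQ hdef T
end
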